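/- Forbidden configuration H₂: no locally optimal geometric graph G on ℤ² contains all nine of the edges {(1,2),(0,2)}, {(0,2),(−1,2)}, {(−1,2),(−1,1)}, {(−1,1),(−1,0)}, {(−1,0),(0,0)}, {(0,0),(1,0)}, {(1,0),(0,1)}, {(0,1),(1,1)}, {(1,1),(0,2)} simultaneously. -/

import Mathlib

open SimpleGraph ENNReal

/-- The point of the Euclidean plane (identified with `ℂ`) corresponding to a lattice point. -/
noncomputable def toC (p : ℤ × ℤ) : ℂ := ⟨(p.1 : ℝ), (p.2 : ℝ)⟩

/-- The Euclidean length of a walk in a geometric graph on `ℤ²`: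
the sum of the Euclidean lengths of its edges. -/
noncomputable def walkLen (G : SimpleGraph (ℤ × ℤ)) :
    ∀ {p q : ℤ × ℤ}, G.Walk p q → ℝ
  | _, _, .nil => 0
  | p, _, .cons (v := v) _ w => dist (toC p) (toC v) + walkLen G w

/-- The graph distance `d_G(p,q)`: infimum of Euclidean lengths of walks from `p` to `q`
(`∞` if there is no walk). -/
noncomputable def gdist (G : SimpleGraph (ℤ × ℤ)) (p q : ℤ × ℤ) : ℝ≥0∞ :=
  ⨅ w : G.Walk p q, ENNReal.ofReal (walkLen G w)

/-- `G` has maximum degree at most `3`. -/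
def MaxDegThree (G : SimpleGraph (ℤ × ℤ)) : Prop :=
  ∀ v : ℤ × ℤ, (G.neighborSet v).encard ≤ 3

/-- `G` is plane: two distinct edges, viewed as closed segments in the plane,
intersect at most in a common endpoint. -/
def IsPlane (G : SimpleGraph (ℤ × ℤ)) : Prop :=
  ∀ a b c d : ℤ × ℤ, G.Adj a b → G.Adj c d → s(a, b) ≠ s(c, d) →
    ∀ x : ℂ, x ∈ segment ℝ (toC a) (toC b) → x ∈ segment ℝ (toC c) (toC d) →
      x ∈ ({toC a, toC b} : Set ℂ) ∧ x ∈ ({toC c, toC d} : Set ℂ)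

/-- `G` is locally optimal. -/
def LocallyOptimal (G : SimpleGraph (ℤ × ℤ)) : Prop :=
  IsPlane G ∧ MaxDegThree G ∧
    ∀ p q : ℤ × ℤ, dist (toC p) (toC q) ≤ Real.sqrt 5 →
      gdist G p q ≤ ENNReal.ofReal ((1 + Real.sqrt 2) * dist (toC p) (toC q))

/-- The dilation of `G`. -/
noncomputable def dil (G : SimpleGraph (ℤ × ℤ)) : ℝ≥0∞ :=
  ⨆ (p : ℤ × ℤ) (q : ℤ × ℤ) (_ : p ≠ q),
    gdist G p q / ENNReal.ofReal (dist (toC p) (toC q))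

/-! ### A search procedure for refuting finite configurations of edges -/

/-- The squared Euclidean norm of a lattice vector. -/
def sqNorm (v : ℤ × ℤ) : ℤ := v.1 * v.1 + v.2 * v.2

/-- Twice the signed area of the triangle `abc`. -/
def orient (a b c : ℤ × ℤ) : ℤ :=
  (b.1 - a.1) * (c.2 - a.2) - (b.2 - a.2) * (c.1 - a.1)

/-- The segments `ab` and `cd` cross in a point interior to both of them. -/
def crosses (a b c d : ℤ × ℤ) : Bool :=
  decide (orient a b c * orient a b d < 0) && decide (orient c d a * orient c d b < 0)

/-- The vertices joined to `v` by an edge listed in `E`. -/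
def neighbors (E : List ((ℤ × ℤ) × (ℤ × ℤ))) (v : ℤ × ℤ) : List (ℤ × ℤ) :=
  E.filterMap fun e => if e.1 = v then some e.2 else if e.2 = v then some e.1 else none

/-- Adding the new edge `vw` to `E` would violate planarity or the degree bound. -/
def blocked (E : List ((ℤ × ℤ) × (ℤ × ℤ))) (v w : ℤ × ℤ) : Bool :=
  decide (3 ≤ (neighbors E v).dedup.length) || decide (3 ≤ (neighbors E w).dedup.length) ||
    E.any fun e => crosses v w e.1 e.2

/-- The primitive lattice vectors of squared norm at most `29`, grouped by norm; each group comes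
with a lower bound for `1000` times its norm. -/
def steps : List (ℤ × List (ℤ × ℤ)) :=
  [(1000,
     [(-1, 0), (0, -1), (0, 1), (1, 0)]),
   (1414,
     [(-1, -1), (-1, 1), (1, -1), (1, 1)]),
   (2236,
     [(-2, -1), (-2, 1), (-1, -2), (-1, 2), (1, -2), (1, 2), (2, -1), (2, 1)]),
   (3162,
     [(-3, -1), (-3, 1), (-1, -3), (-1, 3), (1, -3), (1, 3), (3, -1), (3, 1)]),
   (3605,
     [(-3, -2), (-3, 2), (-2, -3), (-2, 3), (2, -3), (2, 3), (3, -2), (3, 2)]),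
   (4123,
     [(-4, -1), (-4, 1), (-1, -4), (-1, 4), (1, -4), (1, 4), (4, -1), (4, 1)]),
   (5000,
     [(-4, -3), (-4, 3), (-3, -4), (-3, 4), (3, -4), (3, 4), (4, -3), (4, 3)]),
   (5099,
     [(-5, -1), (-5, 1), (-1, -5), (-1, 5), (1, -5), (1, 5), (5, -1), (5, 1)]),
   (5385,
     [(-5, -2), (-5, 2), (-2, -5), (-2, 5), (2, -5), (2, 5), (5, -2), (5, 2)])]

/-- Pairs `(n, b)` with `1000 * (1 + √2) * √n < b`. -/
def budgets : List (ℤ × ℤ) := [(1, 2415), (2, 3415), (4, 4829), (5, 5399)]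

/-- All ways of extending the edge list `E` by a path with at most `n` edges from `v` to `q` that
avoids `vis` and has length at most `b / 1000`; paths with more edges are represented by their
first `n` edges. -/
def explore : ℕ → List ((ℤ × ℤ) × (ℤ × ℤ)) → List (ℤ × ℤ) → ℤ × ℤ → ℤ × ℤ → ℤ →
    List (List ((ℤ × ℤ) × (ℤ × ℤ)))
  | 0, E, _, _, _, _ => [E]
  | n + 1, E, vis, v, q, b =>
    if v = q then [E] else
      steps.flatMap fun g => if b < g.1 then [] else
        g.2.flatMap fun s =>
          if (b - g.1) * (b - g.1) < 1000000 * sqNorm (q - (v + s)) then []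
          else if v + s ∈ vis then []
          else if v + s ∈ neighbors E v then explore n E (v :: vis) (v + s) q (b - g.1)
          else if blocked E v (v + s) then []
          else explore n ((v, v + s) :: E) (v :: vis) (v + s) q (b - g.1)

/-- All ways of extending `E` by a short path from `p` to `q`. -/
def branches (p q : ℤ × ℤ) (E : List ((ℤ × ℤ) × (ℤ × ℤ))) : List (List ((ℤ × ℤ) × (ℤ × ℤ))) :=
  match budgets.lookup (sqNorm (q - p)) with
  | some b => explore 6 E [] p q b
  | none => [E]

/-- Depth-first refutation of all edge lists in the second argument, branching successively on the
short paths between the pairs in the first one. -/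
def refutes : List ((ℤ × ℤ) × (ℤ × ℤ)) → List (List ((ℤ × ℤ) × (ℤ × ℤ))) → Bool
  | _, [] => true
  | [], _ :: _ => false
  | r :: rs, E :: Es => refutes rs (branches r.1 r.2 E ++ Es)

/-- The nine edges of the configuration `H₂`. -/
def edgesH2 : List ((ℤ × ℤ) × (ℤ × ℤ)) :=
  [((1, 2), (0, 2)), ((0, 2), (-1, 2)), ((-1, 2), (-1, 1)), ((-1, 1), (-1, 0)),
   ((-1, 0), (0, 0)), ((0, 0), (1, 0)), ((1, 0), (0, 1)), ((0, 1), (1, 1)), ((1, 1), (0, 2))]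

/-- The pairs of vertices to branch on, in depth-first order, in order to refute `H₂`. -/
def pairsH2 : List ((ℤ × ℤ) × (ℤ × ℤ)) :=
  [((0, 2), (0, 3)), ((-2, 2), (-1, 2)), ((-1, 1), (0, 1)), ((-2, 0), (-1, 0)), ((2, 0), (2, 1)),
   ((-1, 1), (0, 1)), ((-2, 0), (-1, 0)), ((-2, 2), (0, 1)), ((-1, 3), (0, 1)), ((1, 1), (2, 1)),
   ((-1, 3), (0, 1)), ((1, 1), (2, 1)), ((-1, 3), (0, 1)), ((1, 1), (2, 1)), ((-1, 2), (-1, 3)),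
   ((-2, 1), (-1, 1)), ((-1, -1), (-1, 0)), ((1, 0), (2, 0)), ((0, -1), (1, -1)),
   ((1, 0), (2, -1)), ((0, -1), (1, 1)), ((1, 0), (2, -1)), ((1, 0), (3, 1)), ((1, 1), (2, 0)),
   ((1, 0), (2, 2)), ((1, 2), (2, 2)), ((2, 2), (3, 2)), ((2, 2), (2, 3)), ((2, 2), (3, 2)),
   ((1, 3), (2, 3)), ((1, 0), (2, 2)), ((1, 1), (2, 0)), ((1, 2), (2, 2)), ((0, -1), (1, 1)),
   ((2, -1), (2, 0)), ((1, -1), (1, 0)), ((2, 0), (3, 0)), ((0, -1), (1, 1)), ((2, 1), (2, 2)),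
   ((1, -1), (1, 0)), ((2, -1), (3, -1)), ((0, -1), (1, 1)), ((1, 0), (2, 2)), ((1, 0), (3, 1)),
   ((1, 0), (3, 1)), ((1, -1), (1, 0)), ((-1, 2), (-1, 3)), ((-1, 1), (0, 1)),
   ((-2, 0), (-1, 0)), ((-2, 2), (0, 1)), ((-1, 3), (0, 1)), ((1, 1), (2, 1)), ((-1, 3), (0, 1)),
   ((1, 1), (2, 1)), ((-1, 3), (0, 1)), ((1, 1), (2, 1)), ((-1, 2), (-1, 3)), ((-2, 1), (-1, 1)),
   ((-1, -1), (-1, 0)), ((1, 0), (2, 0)), ((1, 1), (2, 1)), ((1, 0), (2, 2)), ((0, -1), (1, 1)),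
   ((1, 0), (3, 1)), ((1, 0), (2, -1)), ((3, -1), (3, 0)), ((0, -1), (1, 1)), ((1, 1), (2, 0)),
   ((1, 0), (2, -1)), ((0, -1), (1, 1)), ((1, -1), (1, 0)), ((2, -1), (3, -1)),
   ((0, -1), (1, 1)), ((1, 1), (2, 1)), ((-1, 2), (-1, 3)), ((1, 1), (2, 1)), ((3, 0), (3, 1)),
   ((-1, 1), (0, 1)), ((-2, 0), (-1, 0)), ((-2, 2), (0, 1)), ((-1, 3), (0, 1)),
   ((-1, 3), (0, 1)), ((-1, 2), (-1, 3)), ((-2, 1), (-1, 1)), ((-1, -1), (-1, 0)),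
   ((1, -1), (1, 0)), ((1, 0), (2, 0)), ((1, 0), (2, 0)), ((0, -1), (1, 1)), ((1, -1), (2, -1)),
   ((0, -1), (1, 1)), ((-1, 2), (-1, 3)), ((3, 1), (3, 2)), ((1, 0), (2, 2)), ((3, 1), (3, 2)),
   ((1, 0), (2, 2)), ((1, 2), (2, 0)), ((2, 1), (2, 2)), ((0, 1), (1, 3)), ((-2, 2), (-1, 2)),
   ((-1, 3), (-1, 4)), ((-1, 3), (0, 3)), ((1, 2), (1, 3)), ((2, 2), (3, 2)), ((2, 3), (2, 4)),
   ((0, 3), (0, 4)), ((0, 2), (1, 4)), ((-2, 3), (-1, 3)), ((-1, 3), (0, 3)), ((0, 2), (1, 4)),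
   ((-1, 4), (0, 4)), ((-2, 2), (0, 3)), ((-1, 4), (0, 3)), ((-1, 2), (-1, 3)),
   ((-2, 3), (-1, 2)), ((-2, 1), (-2, 2)), ((-2, 1), (-2, 2)), ((-2, 1), (-2, 2)),
   ((-1, 3), (0, 1)), ((-3, 1), (-3, 2)), ((-2, 1), (-1, 1)), ((-2, 0), (-1, 0)),
   ((-2, 2), (0, 3)), ((-2, 2), (0, 3)), ((-2, 3), (-2, 4)), ((0, 2), (1, 4)),
   ((-2, 4), (-1, 4)), ((-2, 2), (0, 3)), ((-1, 3), (0, 3)), ((2, 2), (3, 2)), ((2, 1), (2, 2)),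
   ((1, 0), (2, 0)), ((1, 2), (2, 1)), ((1, 2), (2, 0)), ((2, 2), (3, 2)), ((2, 2), (2, 3)),
   ((2, 2), (3, 2)), ((1, 2), (2, 0)), ((1, 3), (2, 2)), ((1, 3), (2, 2))]

set_option maxRecDepth 100000 in
theorem refutes_edgesH2 : refutes pairsH2 [edgesH2] = true := by
  decide +kernel

/-! ### Soundness of the search procedure -/

section Soundness

variable {G : SimpleGraph (ℤ × ℤ)}

theorem toC_injective : Function.Injective toC := by
  rintro ⟨a, b⟩ ⟨c, d⟩ h
  simpa [toC, Complex.ext_iff] using h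

theorem dist_toC (p q : ℤ × ℤ) : dist (toC p) (toC q) = √(sqNorm (q - p) : ℝ) := by
  rw [Complex.dist_eq_re_im]
  simp only [toC, sqNorm, Prod.fst_sub, Prod.snd_sub]
  push_cast
  congr 1
  ring

theorem sq_dist_toC (p q : ℤ × ℤ) : dist (toC p) (toC q) ^ 2 = (sqNorm (q - p) : ℝ) := by
  rw [dist_toC, Real.sq_sqrt]
  have : 0 ≤ sqNorm (q - p) := add_nonneg (mul_self_nonneg _) (mul_self_nonneg _)
  exact_mod_cast this

theorem walkLen_append {p q r : ℤ × ℤ} (u : G.Walk p q) (w : G.Walk q r) :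
    walkLen G (u.append w) = walkLen G u + walkLen G w := by
  induction u with
  | nil => simp [walkLen]
  | cons h u ih => simp [walkLen, ih, add_assoc]

theorem dist_le_walkLen {p q : ℤ × ℤ} (w : G.Walk p q) :
    dist (toC p) (toC q) ≤ walkLen G w := by
  induction w with
  | nil => simp [walkLen]
  | cons h w ih => exact (dist_triangle _ _ _).trans (add_le_add_right ih _)

theorem walkLen_nonneg {p q : ℤ × ℤ} (w : G.Walk p q) : 0 ≤ walkLen G w :=
  dist_nonneg.trans (dist_le_walkLen w)

theorem walkLen_bypass_le {p q : ℤ × ℤ} (w : G.Walk p q) :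
    walkLen G w.bypass ≤ walkLen G w := by
  induction w with
  | nil => simp [Walk.bypass]
  | @cons u v _ h w ih =>
    simp only [Walk.bypass]
    split_ifs with hu
    · have key := congrArg (walkLen G) (w.bypass.take_spec hu)
      rw [walkLen_append] at key
      have h1 := walkLen_nonneg (w.bypass.takeUntil u hu)
      have h2 : 0 ≤ dist (toC u) (toC v) := dist_nonneg
      simp only [walkLen]
      linarith
    · simp only [walkLen]
      linarith

theorem LocallyOptimal.exists_walk (hG : LocallyOptimal G) {p q : ℤ × ℤ}
    (h : sqNorm (q - p) ≤ 5) {c : ℝ} (hc : (1 + √2) * dist (toC p) (toC q) < c) :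
    ∃ w : G.Walk p q, w.IsPath ∧ walkLen G w < c := by
  have hd : dist (toC p) (toC q) ≤ √5 := by
    rw [dist_toC]
    exact Real.sqrt_le_sqrt (by exact_mod_cast h)
  have h0 : 0 ≤ (1 + √2) * dist (toC p) (toC q) := by positivity
  have hlt : gdist G p q < ENNReal.ofReal c :=
    (hG.2.2 p q hd).trans_lt ((ENNReal.ofReal_lt_ofReal_iff (h0.trans_lt hc)).2 hc)
  obtain ⟨w, hw⟩ := iInf_lt_iff.1 hlt
  refine ⟨w.bypass, w.bypass_isPath, (walkLen_bypass_le w).trans_lt ?_⟩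
  exact (ENNReal.ofReal_lt_ofReal_iff (h0.trans_lt hc)).1 hw

theorem LocallyOptimal.exists_adj (hG : LocallyOptimal G) (p : ℤ × ℤ) : ∃ q, G.Adj p q := by
  obtain ⟨w, -, -⟩ := hG.exists_walk (p := p) (q := p + (1, 0)) (by simp [sqNorm])
    (lt_add_one _)
  exact ⟨w.snd, w.adj_snd (w.not_nil_of_ne (by simp))⟩

theorem toC_add_mem_segment {p s : ℤ × ℤ} {n : ℕ} (hn : 1 ≤ n) :
    toC (p + s) ∈ segment ℝ (toC p) (toC (p + n • s)) := by
  have hn' : (1 : ℝ) ≤ n := by exact_mod_cast hn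
  rw [segment_eq_image']
  refine ⟨(n : ℝ)⁻¹, ⟨by positivity, inv_le_one_of_one_le₀ hn'⟩, ?_⟩
  have : (n : ℝ) ≠ 0 := by positivity
  apply Complex.ext <;> simp [toC] <;> field_simp

theorem LocallyOptimal.gcd_eq_one (hG : LocallyOptimal G) {p q : ℤ × ℤ} (h : G.Adj p q) :
    Int.gcd (q.1 - p.1) (q.2 - p.2) = 1 := by
  set n := Int.gcd (q.1 - p.1) (q.2 - p.2) with hn
  obtain ⟨a, ha⟩ : (n : ℤ) ∣ q.1 - p.1 := Int.gcd_dvd_left ..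
  obtain ⟨b, hb⟩ : (n : ℤ) ∣ q.2 - p.2 := Int.gcd_dvd_right ..
  have hq : q = p + n • (a, b) := by
    ext <;> simp <;> linarith
  by_contra hne
  have h0 : n ≠ 0 := by
    intro h0
    rw [h0, zero_smul, add_zero] at hq
    exact h.ne hq.symm
  have hp : p + (a, b) ≠ p := by
    intro e
    rw [add_eq_left] at e
    rw [e, smul_zero, add_zero] at hq
    exact h.ne hq.symm
  have hpq : p + (a, b) ≠ q := by
    rw [hq]
    intro e
    replace e := add_left_cancel e
    have h1 : (n - 1 : ℤ) • (a, b) = 0 := by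
      rw [sub_smul, one_smul, natCast_zsmul, ← e, sub_self]
    rcases smul_eq_zero.1 h1 with h2 | h2
    · omega
    · exact hp (by rw [h2, add_zero])
  obtain ⟨r, hr⟩ := hG.exists_adj (p + (a, b))
  have hmem : toC (p + (a, b)) ∈ segment ℝ (toC p) (toC q) := by
    rw [hq]
    exact toC_add_mem_segment (by omega)
  have hs : s(p, q) ≠ s(p + (a, b), r) := by
    intro e
    have : p + (a, b) ∈ s(p, q) := e ▸ Sym2.mem_mk_left _ _
    rcases Sym2.mem_iff.1 this with h1 | h1
    · exact hp h1
    · exact hpq h1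
  rcases (hG.1 _ _ _ _ h hr hs _ hmem (left_mem_segment ℝ _ _)).1 with h1 | h1
  · exact hp (toC_injective h1)
  · exact hpq (toC_injective h1)

theorem orient_eq_zero_of_mem_pair {a b c : ℤ × ℤ} {x : ℂ}
    (h : x ∈ ({toC a, toC b} : Set ℂ)) (hx : x = toC c) : orient a b c = 0 := by
  subst hx
  rcases h with h | h <;> rw [toC_injective h] <;> simp only [orient] <;> ring

theorem exists_mul_sub_eq_of_mul_neg {x y : ℤ} (h : x * y < 0) :
    ∃ t ∈ Set.Icc (0 : ℝ) 1, t * ((x : ℝ) - y) = x := by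
  rcases mul_neg_iff.1 h with ⟨hx, hy⟩ | ⟨hx, hy⟩
  · have hx' : (0 : ℝ) < x := by exact_mod_cast hx
    have hy' : (y : ℝ) < 0 := by exact_mod_cast hy
    exact ⟨x / (x - y), ⟨div_nonneg (by linarith) (by linarith),
      (div_le_one (by linarith)).2 (by linarith)⟩, div_mul_cancel₀ _ (by linarith)⟩
  · have hx' : (x : ℝ) < 0 := by exact_mod_cast hx
    have hy' : (0 : ℝ) < y := by exact_mod_cast hy
    exact ⟨x / (x - y), ⟨div_nonneg_of_nonpos (by linarith) (by linarith),
      (div_le_one_of_neg (by linarith)).2 (by linarith)⟩, div_mul_cancel₀ _ (by linarith)⟩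

theorem IsPlane.not_crosses (hG : IsPlane G) {a b c d : ℤ × ℤ} (hab : G.Adj a b)
    (hcd : G.Adj c d) : crosses a b c d = false := by
  by_contra hcr
  simp only [crosses, Bool.not_eq_false, Bool.and_eq_true, decide_eq_true_eq] at hcr
  obtain ⟨h1, h2⟩ := hcr
  have hs : s(a, b) ≠ s(c, d) := by
    intro e
    rcases Sym2.eq_iff.1 e with ⟨rfl, rfl⟩ | ⟨rfl, rfl⟩ <;>
    · have : ∀ u v : ℤ × ℤ, orient u v u = 0 := fun u v => by simp only [orient]; ring
      simp [this] at h2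
  obtain ⟨t, ht, ht'⟩ := exists_mul_sub_eq_of_mul_neg h2
  obtain ⟨u, hu, hu'⟩ := exists_mul_sub_eq_of_mul_neg h1
  have hD : (orient c d a - orient c d b : ℝ) ≠ 0 := by
    rw [sub_ne_zero]
    intro e
    rw [Int.cast_inj.1 e] at h2
    nlinarith [mul_self_nonneg (orient c d b)]
  have hx : toC a + t • (toC b - toC a) = toC c + u • (toC d - toC c) := by
    simp only [orient] at ht' hu' hD
    push_cast at ht' hu' hD
    apply Complex.ext <;> simp [toC] <;> refine mul_left_cancel₀ hD ?_
    · linear_combination ((b.1 : ℝ) - a.1) * ht' + ((d.1 : ℝ) - c.1) * hu'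
    · linear_combination ((b.2 : ℝ) - a.2) * ht' + ((d.2 : ℝ) - c.2) * hu'
  obtain ⟨hxab, hxcd⟩ := hG a b c d hab hcd hs (toC a + t • (toC b - toC a))
    (by rw [segment_eq_image']; exact ⟨t, ht, rfl⟩)
    (by rw [hx, segment_eq_image']; exact ⟨u, hu, rfl⟩)
  have h0 : orient a b c = 0 ∨ orient a b d = 0 := by
    rcases hxcd with e | e
    · exact .inl (orient_eq_zero_of_mem_pair hxab e)
    · exact .inr (orient_eq_zero_of_mem_pair hxab e)
  rcases h0 with e | e <;> simp [e] at h1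

theorem MaxDegThree.length_le (hG : MaxDegThree G) {v : ℤ × ℤ} {l : List (ℤ × ℤ)}
    (hl : l.Nodup) (h : ∀ w ∈ l, G.Adj v w) : l.length ≤ 3 := by
  have h1 : ((l.toFinset : Set (ℤ × ℤ))).encard ≤ 3 :=
    (Set.encard_le_encard fun w hw => h w (by simpa using hw)).trans (hG v)
  rw [Set.encard_coe_eq_coe_finsetCard, List.toFinset_card_of_nodup hl] at h1
  exact_mod_cast h1

/-- All the listed edges are edges of `G`. -/
def Realizes (G : SimpleGraph (ℤ × ℤ)) (E : List ((ℤ × ℤ) × (ℤ × ℤ))) : Prop :=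
  ∀ e ∈ E, G.Adj e.1 e.2

theorem neighbors_symm {E : List ((ℤ × ℤ) × (ℤ × ℤ))} {v w : ℤ × ℤ} (h : w ∈ neighbors E v) :
    v ∈ neighbors E w := by
  obtain ⟨e, he, h⟩ := List.mem_filterMap.1 h
  refine List.mem_filterMap.2 ⟨e, he, ?_⟩
  grind

theorem Realizes.adj_of_mem_neighbors {E : List ((ℤ × ℤ) × (ℤ × ℤ))} (hE : Realizes G E)
    {v w : ℤ × ℤ} (h : w ∈ neighbors E v) : G.Adj v w := by
  obtain ⟨e, he, h⟩ := List.mem_filterMap.1 h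
  split_ifs at h with h1 h2
  · cases h; exact h1 ▸ hE e he
  · cases h; exact h2 ▸ (hE e he).symm

theorem Realizes.length_dedup_neighbors_lt {E : List ((ℤ × ℤ) × (ℤ × ℤ))} (hE : Realizes G E)
    (hG : MaxDegThree G) {v w : ℤ × ℤ} (h : G.Adj v w) (hw : w ∉ neighbors E v) :
    (neighbors E v).dedup.length < 3 := by
  have := hG.length_le (v := v) (l := w :: (neighbors E v).dedup)
    (List.nodup_cons.2 ⟨by simpa using hw, List.nodup_dedup _⟩) (by
      simp only [List.mem_cons, List.mem_dedup, forall_eq_or_imp]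
      exact ⟨h, fun u hu => hE.adj_of_mem_neighbors hu⟩)
  simpa using this

theorem Realizes.blocked_eq_false {E : List ((ℤ × ℤ) × (ℤ × ℤ))} (hE : Realizes G E)
    (hG : LocallyOptimal G) {v w : ℤ × ℤ} (h : G.Adj v w) (hw : w ∉ neighbors E v) :
    blocked E v w = false := by
  have h1 := hE.length_dedup_neighbors_lt hG.2.1 h hw
  have h2 := hE.length_dedup_neighbors_lt hG.2.1 h.symm fun hv => hw (neighbors_symm hv)
  have h3 : ∀ e ∈ E, crosses v w e.1 e.2 = false := fun e he => hG.1.not_crosses h (hE e he)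
  simp only [blocked, Bool.or_eq_false_iff, decide_eq_false_iff_not, not_le, List.any_eq_false,
    Bool.not_eq_true]
  exact ⟨⟨h1, h2⟩, h3⟩

theorem exists_mem_steps {s : ℤ × ℤ} (hs : Int.gcd s.1 s.2 = 1)
    (h : 1000000 * sqNorm s ≤ 5399 * 5399) : ∃ g ∈ steps, s ∈ g.2 := by
  have key : ∀ x ∈ Finset.Icc (-5 : ℤ) 5, ∀ y ∈ Finset.Icc (-5 : ℤ) 5, Int.gcd x y = 1 →
      1000000 * sqNorm (x, y) ≤ 5399 * 5399 → ∃ g ∈ steps, (x, y) ∈ g.2 := by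
    decide +kernel
  have h1 : s.1 * s.1 + s.2 * s.2 < 36 := by
    unfold sqNorm at h
    omega
  refine key s.1 (Finset.mem_Icc.2 ⟨?_, ?_⟩) s.2 (Finset.mem_Icc.2 ⟨?_, ?_⟩) hs h <;>
  nlinarith [mul_self_nonneg s.1, mul_self_nonneg s.2]

theorem le_dist_of_mem_steps {g : ℤ × List (ℤ × ℤ)} (hg : g ∈ steps) {s : ℤ × ℤ} (hs : s ∈ g.2)
    (v : ℤ × ℤ) : (g.1 : ℝ) ≤ 1000 * dist (toC v) (toC (v + s)) := by
  have key : ∀ g ∈ steps, ∀ s ∈ g.2, g.1 * g.1 ≤ 1000000 * sqNorm s := by decide +kernel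
  have h1 : (g.1 : ℝ) * g.1 ≤ 1000000 * (sqNorm s : ℝ) := by exact_mod_cast key g hg s hs
  have h2 := sq_dist_toC v (v + s)
  rw [add_sub_cancel_left] at h2
  exact abs_le_of_sq_le_sq' (by nlinarith) (by positivity) |>.2

theorem Realizes.exists_mem_explore (hG : LocallyOptimal G) {q : ℤ × ℤ} (n : ℕ) :
    ∀ {E : List ((ℤ × ℤ) × (ℤ × ℤ))} {vis : List (ℤ × ℤ)} {v : ℤ × ℤ} {b : ℤ} (w : G.Walk v q),
      w.IsPath → (∀ x ∈ w.support, x ∉ vis) → 1000 * walkLen G w ≤ b → b ≤ 5399 →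
      Realizes G E → ∃ E' ∈ explore n E vis v q b, Realizes G E' := by
  induction n with
  | zero => exact fun {E} _ _ _ _ _ _ _ _ hE => ⟨E, by simp [explore], hE⟩
  | succ n ih =>
    intro E vis v b w hp hvis hw hb hE
    cases w with
    | nil => exact ⟨E, by simp [explore], hE⟩
    | @cons _ u _ hvu w =>
      rw [Walk.cons_isPath_iff] at hp
      have hvq : v ≠ q := by
        rintro rfl
        exact hp.2 w.end_mem_support
      obtain ⟨s, rfl⟩ : ∃ s, u = v + s := ⟨u - v, by abel⟩
      simp only [walkLen] at hw
      have hnn := walkLen_nonneg w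
      have hbR : (b : ℝ) ≤ 5399 := by exact_mod_cast hb
      have hd : dist (toC v) (toC (v + s)) * 1000 ≤ 5399 := by linarith
      have hsq := sq_dist_toC v (v + s)
      have hd0 : 0 ≤ dist (toC v) (toC (v + s)) := dist_nonneg
      rw [add_sub_cancel_left] at hsq
      obtain ⟨g, hg, hs⟩ := exists_mem_steps (s := s) (by simpa using hG.gcd_eq_one hvu) (by
        have : (1000000 * (sqNorm s : ℝ)) ≤ 5399 * 5399 := by rw [← hsq]; nlinarith
        exact_mod_cast this)
      have hgd := le_dist_of_mem_steps hg hs v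
      have hw' : 1000 * walkLen G w ≤ ((b - g.1 : ℤ) : ℝ) := by push_cast; linarith
      have hbg : 0 ≤ b - g.1 := by
        have : (0 : ℝ) ≤ ((b - g.1 : ℤ) : ℝ) := by linarith
        exact_mod_cast this
      have hg0 : 0 ≤ g.1 := (by decide : ∀ g ∈ steps, 0 ≤ g.1) g hg
      have hfar : ¬ (b - g.1) * (b - g.1) < 1000000 * sqNorm (q - (v + s)) := by
        rw [not_lt]
        have h1 := (dist_le_walkLen w)
        have h2 := sq_dist_toC (v + s) q
        have h3 : 0 ≤ dist (toC (v + s)) (toC q) := dist_nonneg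
        have : 1000000 * (sqNorm (q - (v + s)) : ℝ) ≤
            ((b - g.1 : ℤ) : ℝ) * ((b - g.1 : ℤ) : ℝ) := by
          rw [← h2]
          nlinarith
        exact_mod_cast this
      have hvs : v + s ∉ vis := hvis _ (by simp)
      have hvis' : ∀ x ∈ w.support, x ∉ v :: vis := by
        intro x hx hxv
        rcases List.mem_cons.1 hxv with rfl | hxv
        · exact hp.2 hx
        · exact hvis x (by simp [hx]) hxv
      have hmem : ∀ {E'}, (if v + s ∈ neighbors E v then
            E' ∈ explore n E (v :: vis) (v + s) q (b - g.1)
          else E' ∈ explore n ((v, v + s) :: E) (v :: vis) (v + s) q (b - g.1)) →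
          E' ∈ explore (n + 1) E vis v q b := by
        intro E' h
        rw [explore, if_neg hvq]
        refine List.mem_flatMap.2 ⟨g, hg, ?_⟩
        rw [if_neg (by omega)]
        refine List.mem_flatMap.2 ⟨s, hs, ?_⟩
        rw [if_neg hfar, if_neg hvs]
        split_ifs at h ⊢ with h1 h2
        · exact h
        · simp [hE.blocked_eq_false hG hvu h1] at h2
        · exact h
      by_cases h1 : v + s ∈ neighbors E v
      · obtain ⟨E', hE', hr⟩ := ih w hp.1 hvis' hw' (by omega) hE
        exact ⟨E', hmem (by rwa [if_pos h1]), hr⟩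
      · obtain ⟨E', hE', hr⟩ := ih (E := (v, v + s) :: E) w hp.1 hvis' hw' (by omega) (by
          simpa [Realizes] using ⟨hvu, fun a b c d h => hE _ h⟩)
        exact ⟨E', hmem (by rwa [if_neg h1]), hr⟩

theorem mul_dist_lt_of_mem_budgets {p q : ℤ × ℤ} {b : ℤ} (h : (sqNorm (q - p), b) ∈ budgets) :
    (1 + √2) * dist (toC p) (toC q) < b / 1000 := by
  have key : ∀ x ∈ budgets, 241422 * 241422 * x.1 < 10000 * (x.2 * x.2) ∧ 0 < x.2 := by decide
  have h1 := sq_dist_toC p q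
  obtain ⟨h2, h3⟩ := key _ h
  have h2' : 241422 * 241422 * (sqNorm (q - p) : ℝ) < 10000 * ((b : ℝ) * b) := by
    exact_mod_cast h2
  have h3' : (0 : ℝ) < b := by exact_mod_cast h3
  have h4 : √2 < 1.41422 := by
    rw [Real.sqrt_lt' (by norm_num)]
    norm_num
  have hd : 0 ≤ dist (toC p) (toC q) := dist_nonneg
  have h5 : 2.41422 * dist (toC p) (toC q) < b / 1000 := by
    refine lt_of_pow_lt_pow_left₀ 2 (by positivity) ?_
    rw [mul_pow, h1]
    nlinarith
  nlinarith

theorem Realizes.exists_mem_branches {E : List ((ℤ × ℤ) × (ℤ × ℤ))} (hE : Realizes G E)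
    (hG : LocallyOptimal G) (p q : ℤ × ℤ) : ∃ E' ∈ branches p q E, Realizes G E' := by
  unfold branches
  split
  · next b hb =>
    obtain ⟨l₁, l₂, hl, -⟩ := List.lookup_eq_some_iff.1 hb
    have hmem : (sqNorm (q - p), b) ∈ budgets := by simp [hl]
    have key : ∀ x ∈ budgets, x.1 ≤ 5 ∧ x.2 ≤ 5399 := by decide
    obtain ⟨w, hp, hw⟩ := hG.exists_walk (key _ hmem).1 (mul_dist_lt_of_mem_budgets hmem)
    exact exists_mem_explore hG 6 w hp (by simp) (by linarith) (key _ hmem).2 hE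
  · exact ⟨E, by simp, hE⟩

theorem not_realizes_of_refutes (hG : LocallyOptimal G) (rs : List ((ℤ × ℤ) × (ℤ × ℤ))) :
    ∀ {Es : List (List ((ℤ × ℤ) × (ℤ × ℤ)))}, refutes rs Es = true →
      ∀ E ∈ Es, ¬ Realizes G E := by
  induction rs with
  | nil =>
    rintro (_ | ⟨E, Es⟩) h
    · simp
    · simp [refutes] at h
  | cons r rs ih =>
    rintro (_ | ⟨E, Es⟩) h
    · simp
    · have h' := ih (Es := branches r.1 r.2 E ++ Es) (by simpa [refutes] using h)
      rintro F hF hr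
      rcases List.mem_cons.1 hF with rfl | hF
      · obtain ⟨E', hE', hr'⟩ := hr.exists_mem_branches hG r.1 r.2
        exact h' E' (List.mem_append_left _ hE') hr'
      · exact h' F (List.mem_append_right _ hF) hr

end Soundness

/-- Forbidden configuration H₂: no locally optimal graph contains all nine listed edges. -/
theorem forbidden_H2 (G : SimpleGraph (ℤ × ℤ)) (hG : LocallyOptimal G) :
    ¬ (G.Adj (1, 2) (0, 2) ∧ G.Adj (0, 2) (-1, 2) ∧ G.Adj (-1, 2) (-1, 1) ∧
        G.Adj (-1, 1) (-1, 0) ∧ G.Adj (-1, 0) (0, 0) ∧ G.Adj (0, 0) (1, 0) ∧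
        G.Adj (1, 0) (0, 1) ∧ G.Adj (0, 1) (1, 1) ∧ G.Adj (1, 1) (0, 2)) := by
  rintro ⟨h₁, h₂, h₃, h₄, h₅, h₆, h₇, h₈, h₉⟩
  refine not_realizes_of_refutes hG pairsH2 refutes_edgesH2 edgesH2 (by simp) ?_
  simp [Realizes, edgesH2, *]
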